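/- arXiv:1902.04830 — 2 statements merged into one kernel-verified Lean document; each statement's English description precedes it below -/
import Mathlib

section
/- Let V be a finite-dimensional complex vector space, h a non-degenerate Hermitian form on V, and T : V → V a ℂ-linear endomorphism with T^d = id for some positive integer d that preserves h. For every ζ ∈ ℂ, the real bilinear form ϑ(x,y) := Im h(x,y) restricted to the eigenspace ker(T − ζ·id), viewed as a real vector space, is alternating and non-degenerate (i.e., it is a symplectic form on this eigenspace). -/
/-- The imaginary part of a nondegenerate Hermitian form preserved by a finite-order
endomorphism restricts to a symplectic (alternating, nondegenerate) real form
on each eigenspace. -/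
theorem stmt_2 {V : Type*} [AddCommGroup V] [Module ℂ V] [FiniteDimensional ℂ V]
    (h : V → V → ℂ)
    (hadd : ∀ x y z, h (x + y) z = h x z + h y z)
    (hsmul : ∀ (c : ℂ) (x y : V), h (c • x) y = c * h x y)
    (hsymm : ∀ x y, h y x = starRingEnd ℂ (h x y))
    (hnd : ∀ x, (∀ y, h x y = 0) → x = 0)
    (d : ℕ) (hd : 0 < d) (T : V →ₗ[ℂ] V) (hTd : T ^ d = 1)
    (hTh : ∀ x y, h (T x) (T y) = h x y) (ζ : ℂ) :
    (∀ x ∈ LinearMap.ker (T - ζ • 1), (h x x).im = 0) ∧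
      (∀ x ∈ LinearMap.ker (T - ζ • 1),
        (∀ y ∈ LinearMap.ker (T - ζ • 1), (h x y).im = 0) → x = 0) := by
  have hsmul' : ∀ (c : ℂ) (x y : V), h x (c • y) = starRingEnd ℂ c * h x y := by
    intro c x y
    rw [hsymm (c • y) x, hsmul, map_mul, ← hsymm]
  have hadd' : ∀ x y z, h x (y + z) = h x y + h x z := by
    intro x y z
    rw [hsymm (y + z) x, hadd, map_add, ← hsymm, ← hsymm]
  have hmem : ∀ x, x ∈ LinearMap.ker (T - ζ • 1) ↔ T x = ζ • x := by
    intro x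
    simp [LinearMap.mem_ker, sub_eq_zero]
  refine ⟨fun x _ => Complex.conj_eq_iff_im.mp (hsymm x x).symm, ?_⟩
  intro x hx hy
  by_contra hx0
  rw [hmem] at hx
  have hpow : ∀ k : ℕ, (T ^ k) x = ζ ^ k • x := by
    intro k
    induction k with
    | zero => simp
    | succ k ih => rw [pow_succ', Module.End.mul_apply, ih, map_smul, hx, smul_smul, pow_succ]
  have hζ : ζ ^ d = 1 := by
    have h1 := hpow d
    rw [hTd, Module.End.one_apply] at h1
    have h2 : (ζ ^ d - 1) • x = 0 := by rw [sub_smul, ← h1, one_smul, sub_self]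
    rcases smul_eq_zero.mp h2 with h3 | h3
    · exact sub_eq_zero.mp h3
    · exact absurd h3 hx0
  have hn : ‖ζ‖ = 1 := Complex.norm_eq_one_of_pow_eq_one hζ hd.ne'
  have hζ0 : ζ ≠ 0 := by
    intro h0
    simp [h0] at hn
  have hc : ζ⁻¹ * starRingEnd ℂ ζ⁻¹ = 1 := by
    rw [Complex.mul_conj, Complex.normSq_eq_norm_sq, norm_inv, hn]; simp
  have hS : ∀ (k : ℕ) (v : V), h x (((ζ⁻¹ • T) ^ k) v) = h x v := by
    intro k v
    induction k with
    | zero => simp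
    | succ k ih =>
      have hxx : x = ζ⁻¹ • T x := by rw [hx, smul_smul, inv_mul_cancel₀ hζ0, one_smul]
      rw [pow_succ', Module.End.mul_apply, LinearMap.smul_apply]
      conv_lhs => rw [hxx]
      rw [hsmul, hsmul', ← mul_assoc, hc, one_mul, hTh, ih]
  have hSd : (ζ⁻¹ • T) ^ d = 1 := by
    rw [smul_pow, hTd, inv_pow, hζ, inv_one, one_smul]
  have hsum : ∀ (n : ℕ) (v : V),
      h x (∑ k ∈ Finset.range n, ((ζ⁻¹ • T) ^ k) v) = n * h x v := by
    intro n v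
    induction n with
    | zero =>
      have := hsmul' 0 x 0
      simpa using this
    | succ n ih => rw [Finset.sum_range_succ, hadd', ih, hS]; push_cast; ring
  apply hx0
  apply hnd
  intro v
  set y := ∑ k ∈ Finset.range d, ((ζ⁻¹ • T) ^ k) v with hydef
  have hSy : (ζ⁻¹ • T) y = y := by
    have h1 := Finset.sum_range_succ (fun k => ((ζ⁻¹ • T) ^ k) v) d
    rw [Finset.sum_range_succ'] at h1
    simp only [hSd, pow_zero] at h1
    have h2 := add_right_cancel h1
    rw [hydef, map_sum, ← h2]
    refine (Finset.sum_congr rfl fun k _ => ?_)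
    rw [pow_succ', Module.End.mul_apply]
  have hTy : T y = ζ • y := by
    conv_rhs => rw [← hSy]
    rw [LinearMap.smul_apply, smul_smul, mul_inv_cancel₀ hζ0, one_smul]
  have him := hy y ((hmem y).2 hTy)
  have hre := hy (Complex.I • y) ((hmem _).2 (by rw [map_smul, hTy, smul_comm]))
  rw [hsmul'] at hre
  have h0 : h x y = 0 := by
    apply Complex.ext
    · simpa using hre
    · simpa using him
  rw [hsum] at h0
  rcases mul_eq_zero.mp h0 with h3 | h3
  · exact absurd (Nat.cast_eq_zero.mp h3) hd.ne'
  · exact h3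
end

section
/- Let g ≥ 0 and n ≥ 1 be integers and set m = 2g + n − 1. Work in the exterior algebra over ℂ of the vector space ℂ^{2m}; let x_1, y_1, x_2, y_2, …, x_m, y_m denote the images under the canonical inclusion of the 2m standard basis vectors of ℂ^{2m}, and set z_j = x_j + i·y_j and z̄_j = x_j − i·y_j for j = 1,…,m, where i is the imaginary unit acting as a scalar. Define ϑ = (1/4)·Σ_{j=1}^{g} (z_j·z̄_{g+j} − z_{g+j}·z̄_j). Then (1/(2g)!)·(i/2)^{n−1}·ϑ^{2g}·(z_{2g+1}·z̄_{2g+1})·(z_{2g+2}·z̄_{2g+2}) ⋯ (z_m·z̄_m) = ((−1)^g / 2^{2g})·(x_1·y_1)·(x_2·y_2) ⋯ (x_m·y_m). -/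
theorem aux_pow {R ι : Type*} [CommRing R] [DecidableEq ι] (s : Finset ι) (f : ι → R)
    (hf : ∀ i, f i * f i = 0) :
    (∑ i ∈ s, f i) ^ s.card = (s.card.factorial : R) * ∏ i ∈ s, f i ∧
    (∑ i ∈ s, f i) ^ (s.card + 1) = 0 := by
  induction s using Finset.induction_on with
  | empty => simp
  | insert a s ha ih =>
    obtain ⟨h1, h2⟩ := ih
    rw [Finset.sum_insert ha, Finset.prod_insert ha, Finset.card_insert_of_notMem ha]
    set S := ∑ i ∈ s, f i
    have key : ∀ N : ℕ, (f a + S) ^ (N + 1) = S ^ (N + 1) + (N + 1 : ℕ) * (f a * S ^ N) := by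
      intro N
      induction N with
      | zero => simp; ring
      | succ N ih =>
        rw [pow_succ, ih]
        push_cast
        linear_combination ((N : R) + 1) * S ^ N * hf a
    constructor
    · rw [key, h2, h1, Nat.factorial_succ]; push_cast; ring
    · rw [key, pow_succ S (s.card + 1), h2]; ring

theorem aux_center {V : Type*} [AddCommGroup V] [Module ℂ V] (u v : V) :
    ExteriorAlgebra.ι ℂ u * ExteriorAlgebra.ι ℂ v ∈
      Subalgebra.center ℂ (ExteriorAlgebra ℂ V) := by
  have sw : ∀ a b : V, ExteriorAlgebra.ι ℂ a * ExteriorAlgebra.ι ℂ b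
      = - (ExteriorAlgebra.ι ℂ b * ExteriorAlgebra.ι ℂ a) := fun a b =>
    eq_neg_of_add_eq_zero_left (ExteriorAlgebra.ι_add_mul_swap a b)
  rw [Subalgebra.mem_center_iff]
  intro t
  induction t using ExteriorAlgebra.induction with
  | algebraMap r => exact Algebra.commutes r _
  | ι t =>
    rw [← mul_assoc, sw t u, neg_mul, mul_assoc, sw t v, mul_neg, neg_neg, mul_assoc]
  | mul a b ha hb => rw [mul_assoc, hb, ← mul_assoc, ha, mul_assoc]
  | add a b ha hb => rw [add_mul, mul_add, ha, hb]

theorem aux_abs {C : Type*} [CommRing C] [Algebra ℂ C] (g k : ℕ)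
    (Z : Fin (g + g + k) → Fin (g + g + k) → C) (X : Fin (g + g + k) → C)
    (hZX : ∀ j, Z j j = (-2 * Complex.I) • X j)
    (hZsq : ∀ i j, Z i j * Z i j = 0)
    (hZZ : ∀ i j, Z i j * Z j i = - (Z i i * Z j j)) :
    (((2 * g).factorial : ℂ)⁻¹ * (Complex.I / 2) ^ k) •
        (((1 / 4 : ℂ) • ∑ j : Fin g,
        (Z (Fin.castAdd k (Fin.castAdd g j)) (Fin.castAdd k (Fin.natAdd g j))
          - Z (Fin.castAdd k (Fin.natAdd g j)) (Fin.castAdd k (Fin.castAdd g j)))) ^ (2 * g) *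
          (∏ j : Fin (g + g + k), if 2 * g ≤ j.1 then Z j j else 1))
      = ((-1 : ℂ) ^ g / 2 ^ (2 * g)) • ∏ j : Fin (g + g + k), X j := by
    let F : Fin g ⊕ Fin g → C := Sum.elim
      (fun j => Z (Fin.castAdd k (Fin.castAdd g j)) (Fin.castAdd k (Fin.natAdd g j)))
      (fun j => - Z (Fin.castAdd k (Fin.natAdd g j)) (Fin.castAdd k (Fin.castAdd g j)))
    have hF := (aux_pow Finset.univ F (by
      rintro (j | j)
      · exact hZsq _ _
      · change -Z _ _ * -Z _ _ = 0
        rw [neg_mul_neg]; exact hZsq _ _)).1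
    have hcard : (Finset.univ : Finset (Fin g ⊕ Fin g)).card = 2 * g := by
      simp [two_mul]
    rw [hcard, Fintype.sum_sum_type, Fintype.prod_sum_type, ← Finset.sum_add_distrib,
      ← Finset.prod_mul_distrib] at hF
    simp only [F, Sum.elim_inl, Sum.elim_inr, ← sub_eq_add_neg, mul_neg, hZZ, neg_neg, hZX] at hF
    rw [smul_pow, hF, Fin.prod_univ_add, Fin.prod_univ_add, Fin.prod_univ_add, Fin.prod_univ_add]
    have e1 : ∀ j : Fin g, ¬ (2 * g ≤ j.1) := fun j => by omega
    have e2 : ∀ j : Fin g, ¬ (2 * g ≤ g + j.1) := fun j => by omega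
    have e3 : ∀ j : Fin k, (2 * g ≤ g + g + j.1) := fun j => by omega
    simp only [Fin.val_castAdd, Fin.val_natAdd, e1, e2, e3, if_true, if_false, hZX,
      Finset.prod_const_one, one_mul, smul_mul_smul_comm, Finset.prod_smul, Finset.prod_const,
      Finset.card_univ, Fintype.card_fin, Finset.prod_mul_distrib, Finset.prod_pow]
    rw [← map_natCast (algebraMap ℂ C), ← Algebra.smul_def]
    simp only [smul_mul_assoc, mul_smul_comm, smul_smul]
    congr 1
    have hfac : ((2 * g).factorial : ℂ) ≠ 0 := by exact_mod_cast Nat.factorial_ne_zero _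
    have i1 : (Complex.I / 2) ^ k * (-2 * Complex.I) ^ k = 1 := by
      rw [← mul_pow]
      have : Complex.I / 2 * (-2 * Complex.I) = 1 := by
        linear_combination - Complex.I_mul_I
      rw [this, one_pow]
    have i2 : (1 / 4 : ℂ) ^ (2 * g) * (-2 * Complex.I * (-2 * Complex.I)) ^ g
        = (-1) ^ g / 2 ^ (2 * g) := by
      rw [pow_mul, pow_mul, ← mul_pow, ← div_pow]
      congr 1
      linear_combination (1 / 4 : ℂ) * Complex.I_mul_I
    rw [← i2]
    linear_combination (1 / 4 : ℂ) ^ (2 * g) * (-2 * Complex.I * (-2 * Complex.I)) ^ g * i1 + (1 / 4 : ℂ) ^ (2 * g) * (-2 * Complex.I * (-2 * Complex.I)) ^ g * (Complex.I / 2) ^ k * (-2 * Complex.I) ^ k * inv_mul_cancel₀ hfac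

theorem aux_main {V : Type*} [AddCommGroup V] [Module ℂ V] (g k : ℕ)
    (p q : Fin (g + g + k) → V) (x y z w : Fin (g + g + k) → ExteriorAlgebra ℂ V)
    (hx : ∀ j, x j = ExteriorAlgebra.ι ℂ (p j)) (hy : ∀ j, y j = ExteriorAlgebra.ι ℂ (q j))
    (hz : ∀ j, z j = x j + Complex.I • y j)
    (hw : ∀ j, w j = x j - Complex.I • y j) :
    (((2 * g).factorial : ℂ)⁻¹ * (Complex.I / 2) ^ k) •
        (((1 / 4 : ℂ) • ∑ j : Fin g,
        (z (Fin.castAdd k (Fin.castAdd g j)) * w (Fin.castAdd k (Fin.natAdd g j))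
          - z (Fin.castAdd k (Fin.natAdd g j)) * w (Fin.castAdd k (Fin.castAdd g j)))) ^ (2 * g) *
          (List.ofFn (fun j : Fin (g + g + k) => if 2 * g ≤ j.1 then z j * w j else 1)).prod)
      = ((-1 : ℂ) ^ g / 2 ^ (2 * g)) •
          (List.ofFn (fun j : Fin (g + g + k) => x j * y j)).prod := by
  have hz' : ∀ j, z j = ExteriorAlgebra.ι ℂ (p j + Complex.I • q j) := by
    intro j; rw [hz, hx, hy, map_add, map_smul]
  have hw' : ∀ j, w j = ExteriorAlgebra.ι ℂ (p j - Complex.I • q j) := by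
    intro j; rw [hw, hx, hy, map_sub, map_smul]
  have sw : ∀ a b : V, ExteriorAlgebra.ι ℂ a * ExteriorAlgebra.ι ℂ b
      = - (ExteriorAlgebra.ι ℂ b * ExteriorAlgebra.ι ℂ a) := fun a b =>
    eq_neg_of_add_eq_zero_left (ExteriorAlgebra.ι_add_mul_swap a b)
  have hzw : ∀ j, z j * w j = (-2 * Complex.I) • (x j * y j) := by
    intro j
    have h1 : x j * x j = 0 := by rw [hx]; exact ExteriorAlgebra.ι_sq_zero _
    have h2 : y j * y j = 0 := by rw [hy]; exact ExteriorAlgebra.ι_sq_zero _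
    have h3 : y j * x j = - (x j * y j) := by rw [hx, hy]; exact sw _ _
    rw [hz, hw, mul_sub, add_mul, add_mul]
    simp only [smul_mul_assoc, mul_smul_comm, h1, h2, h3]
    module
  let C := Subalgebra.center ℂ (ExteriorAlgebra ℂ V)
  let Z : Fin (g + g + k) → Fin (g + g + k) → C := fun i j =>
    ⟨z i * w j, by rw [hz', hw']; exact aux_center _ _⟩
  let X : Fin (g + g + k) → C := fun j => ⟨x j * y j, by rw [hx, hy]; exact aux_center _ _⟩
  have hZX : ∀ j, Z j j = (-2 * Complex.I) • X j := fun j => Subtype.ext (hzw j)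
  have hZsq : ∀ i j, Z i j * Z i j = 0 := by
    intro i j
    apply Subtype.ext
    change z i * w j * (z i * w j) = 0
    have h : w j * z i = - (z i * w j) := by rw [hz', hw']; exact sw _ _
    have h0 : z i * z i = 0 := by rw [hz']; exact ExteriorAlgebra.ι_sq_zero _
    rw [mul_assoc, ← mul_assoc (w j), h, neg_mul, mul_neg, ← mul_assoc, ← mul_assoc, h0]
    simp
  have hZZ : ∀ i j, Z i j * Z j i = - (Z i i * Z j j) := by
    intro i j
    apply Subtype.ext
    change z i * w j * (z j * w i) = - (z i * w i * (z j * w j))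
    have h : w j * z j = - (z j * w j) := by rw [hz', hw']; exact sw _ _
    have hc : w i * (z j * w j) = (z j * w j) * w i := by
      have := aux_center (p j + Complex.I • q j) (p j - Complex.I • q j)
      rw [Subalgebra.mem_center_iff] at this
      rw [hz' j, hw' j]; exact this _
    rw [mul_assoc (z i) (w i), hc, mul_assoc, ← mul_assoc (w j), h]
    simp [mul_assoc]
  have main : (((2 * g).factorial : ℂ)⁻¹ * (Complex.I / 2) ^ k) •
        (((1 / 4 : ℂ) • ∑ j : Fin g,
        (Z (Fin.castAdd k (Fin.castAdd g j)) (Fin.castAdd k (Fin.natAdd g j))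
          - Z (Fin.castAdd k (Fin.natAdd g j)) (Fin.castAdd k (Fin.castAdd g j)))) ^ (2 * g) *
          (∏ j : Fin (g + g + k), if 2 * g ≤ j.1 then Z j j else 1))
      = ((-1 : ℂ) ^ g / 2 ^ (2 * g)) • ∏ j : Fin (g + g + k), X j := aux_abs g k Z X hZX hZsq hZZ
  have h := congrArg (C.val) main
  rw [← List.prod_ofFn, ← List.prod_ofFn] at h
  simp only [map_smul, map_mul, map_pow, map_sum, map_sub, map_list_prod, List.map_ofFn] at h
  have e : (fun j : Fin (g + g + k) => if 2 * g ≤ j.1 then z j * w j else 1)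
      = (C.val ∘ fun j : Fin (g + g + k) => if 2 * g ≤ j.1 then Z j j else 1) := by
    funext j
    simp only [Function.comp]
    split_ifs <;> rfl
  rw [e]
  exact h

/-- The exterior-algebra computation comparing the canonical volume form with the
Masur–Veech volume form on a stratum of Abelian differentials in genus `g` with
`n` marked points (Proposition 5.4 of the paper). -/
theorem stmt_6 (g n : ℕ) (hn : 1 ≤ n) (m : ℕ) (hm : m = 2 * g + n - 1)
    (x y z w : Fin m → ExteriorAlgebra ℂ (Fin (2 * m) → ℂ))
    (hx : ∀ j : Fin m, x j = ExteriorAlgebra.ι ℂ (Pi.single ⟨2 * j.1, by omega⟩ (1 : ℂ)))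
    (hy : ∀ j : Fin m, y j = ExteriorAlgebra.ι ℂ (Pi.single ⟨2 * j.1 + 1, by omega⟩ (1 : ℂ)))
    (hz : ∀ j, z j = x j + Complex.I • y j)
    (hw : ∀ j, w j = x j - Complex.I • y j)
    (ϑ : ExteriorAlgebra ℂ (Fin (2 * m) → ℂ))
    (hϑ : ϑ = (1 / 4 : ℂ) • ∑ j : Fin g,
        (z ⟨j.1, by omega⟩ * w ⟨g + j.1, by omega⟩
          - z ⟨g + j.1, by omega⟩ * w ⟨j.1, by omega⟩)) :
    (((2 * g).factorial : ℂ)⁻¹ * (Complex.I / 2) ^ (n - 1)) •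
        (ϑ ^ (2 * g) *
          (List.ofFn (fun j : Fin m => if 2 * g ≤ j.1 then z j * w j else 1)).prod)
      = ((-1 : ℂ) ^ g / 2 ^ (2 * g)) •
          (List.ofFn (fun j : Fin m => x j * y j)).prod := by
  obtain ⟨k, rfl⟩ : ∃ k, n = k + 1 := ⟨n - 1, by omega⟩
  obtain rfl : m = g + g + k := by omega
  subst hϑ
  exact aux_main g k _ _ x y z w hx hy hz hw
end
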